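/- For every real ν > −1/2, 2 h_ν'(1) = 1 + ∫₀¹ (1 − t²)^{ν−1/2} (2ν + t²) sin t dt. -/

import Mathlib

noncomputable section

/-- The normalized Struve function of the first kind (real restriction),
`h_ν(x) = (√π/2) ∑ (−1)^n Γ(ν+3/2) x^(n+1) / (4^n Γ(n+3/2) Γ(ν+n+3/2))`. -/
def struveHR (ν : ℝ) (x : ℝ) : ℝ :=
  Real.sqrt Real.pi / 2 *
    ∑' n : ℕ, ((-1 : ℝ) ^ n * Real.Gamma (ν + 3 / 2) * x ^ (n + 1)) /
      (4 ^ n * Real.Gamma ((n : ℝ) + 3 / 2) * Real.Gamma (ν + n + 3 / 2))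

/-- The odd moments of the weight `(1 - t²)^(ν - 1/2)` on `[0, 1]`. -/
def oddMoment (ν : ℝ) (n : ℕ) : ℝ :=
  ∫ t in (0 : ℝ)..1, (1 - t ^ 2) ^ (ν - 1 / 2) * t ^ (2 * n + 1)

/-- The integral of the `n`-th Taylor term of `sin` against `(1 - t²)^(ν - 1/2)` on `[0, 1]`. -/
def sinMoment (ν : ℝ) (n : ℕ) : ℝ :=
  (-1) ^ n * oddMoment ν n / (2 * n + 1).factorial

lemma intervalIntegrable_one_sub_sq_rpow {s : ℝ} (hs : -1 < s) :
    IntervalIntegrable (fun t : ℝ => (1 - t ^ 2) ^ s) MeasureTheory.volume 0 1 := by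
  have h1 : IntervalIntegrable (fun t : ℝ => (1 - t) ^ s) MeasureTheory.volume 0 1 := by
    have := (intervalIntegral.intervalIntegrable_rpow' (a := 0) (b := 1) hs).comp_sub_left 1
    simpa using this.symm
  have h2 : ContinuousOn (fun t : ℝ => (1 + t) ^ s) (Set.uIcc 0 1) := by
    refine ContinuousOn.rpow_const (by fun_prop) fun t ht => Or.inl ?_
    rw [Set.uIcc_of_le zero_le_one] at ht
    linarith [ht.1]
  refine (h1.mul_continuousOn h2).congr fun t ht => ?_
  rw [Set.uIoc_of_le zero_le_one] at ht
  rw [← Real.mul_rpow (by linarith [ht.2]) (by linarith [ht.1])]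
  congr 1
  ring

lemma intervalIntegrable_weight_mul {ν : ℝ} (hν : -(1 / 2) < ν) {g : ℝ → ℝ}
    (hg : Continuous g) :
    IntervalIntegrable (fun t : ℝ => (1 - t ^ 2) ^ (ν - 1 / 2) * g t)
      MeasureTheory.volume 0 1 :=
  (intervalIntegrable_one_sub_sq_rpow (by linarith)).mul_continuousOn hg.continuousOn

lemma one_sub_sq_pos {t : ℝ} (ht : t ∈ Set.Ioo (0 : ℝ) 1) : 0 < 1 - t ^ 2 := by
  nlinarith [ht.1, ht.2]

lemma hasDerivAt_one_sub_sq_rpow (ν : ℝ) {t : ℝ} (ht : t ∈ Set.Ioo (0 : ℝ) 1) :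
    HasDerivAt (fun t : ℝ => (1 - t ^ 2) ^ (ν + 1 / 2))
      (-(2 * ν + 1) * ((1 - t ^ 2) ^ (ν - 1 / 2) * t)) t := by
  have h : HasDerivAt (fun t : ℝ => 1 - t ^ 2) (-(2 * t)) t := by
    simpa using (hasDerivAt_pow 2 t).const_sub 1
  convert h.rpow_const (p := ν + 1 / 2) (Or.inl (one_sub_sq_pos ht).ne') using 1
  rw [show ν + 1 / 2 - 1 = ν - 1 / 2 by ring]
  ring

lemma continuous_one_sub_sq_rpow {ν : ℝ} (hν : -(1 / 2) < ν) :
    Continuous (fun t : ℝ => (1 - t ^ 2) ^ (ν + 1 / 2)) :=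
  Continuous.rpow_const (by fun_prop) fun _ => Or.inr (by linarith)

lemma oddMoment_zero {ν : ℝ} (hν : -(1 / 2) < ν) : (2 * ν + 1) * oddMoment ν 0 = 1 := by
  have h := intervalIntegral.integral_eq_sub_of_hasDerivAt_of_le zero_le_one
    (continuous_one_sub_sq_rpow hν).continuousOn
    (fun t ht => hasDerivAt_one_sub_sq_rpow ν ht)
    ((intervalIntegrable_weight_mul hν continuous_id).const_mul _)
  rw [intervalIntegral.integral_const_mul] at h
  have h0 : (0 : ℝ) ^ (ν + 1 / 2) = 0 := Real.zero_rpow (by linarith)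
  norm_num at h h0
  rw [h0] at h
  simp only [oddMoment]
  norm_num
  linarith

lemma oddMoment_succ {ν : ℝ} (hν : -(1 / 2) < ν) (n : ℕ) :
    (2 * ν + 2 * n + 3) * oddMoment ν (n + 1) = (2 * n + 2) * oddMoment ν n := by
  have hi := (intervalIntegrable_weight_mul hν (continuous_pow (2 * n + 1))).const_mul
    (2 * n + 2 : ℝ)
  have hi' := (intervalIntegrable_weight_mul hν (continuous_pow (2 * (n + 1) + 1))).const_mul
    (2 * ν + 2 * n + 3 : ℝ)
  have hderiv : ∀ t ∈ Set.Ioo (0 : ℝ) 1,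
      HasDerivAt (fun t : ℝ => (1 - t ^ 2) ^ (ν + 1 / 2) * t ^ (2 * n + 2))
        ((2 * n + 2) * ((1 - t ^ 2) ^ (ν - 1 / 2) * t ^ (2 * n + 1)) -
          (2 * ν + 2 * n + 3) * ((1 - t ^ 2) ^ (ν - 1 / 2) * t ^ (2 * (n + 1) + 1))) t := by
    intro t ht
    refine ((hasDerivAt_one_sub_sq_rpow ν ht).mul
      (hasDerivAt_pow (2 * n + 2) t)).congr_deriv ?_
    rw [show ν + 1 / 2 = (ν - 1 / 2) + 1 by ring, Real.rpow_add_one (one_sub_sq_pos ht).ne',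
      show 2 * n + 2 - 1 = 2 * n + 1 by lia]
    push_cast
    ring
  have h := intervalIntegral.integral_eq_sub_of_hasDerivAt_of_le zero_le_one
    ((continuous_one_sub_sq_rpow hν).mul (continuous_pow (2 * n + 2))).continuousOn
    hderiv (hi.sub hi')
  rw [intervalIntegral.integral_sub hi hi', intervalIntegral.integral_const_mul,
    intervalIntegral.integral_const_mul] at h
  have h0 : (0 : ℝ) ^ (ν + 1 / 2) = 0 := Real.zero_rpow (by linarith)
  norm_num at h h0
  rw [h0] at h
  simp only [oddMoment]
  norm_num
  linarith

lemma oddMoment_nonneg_and_le {ν : ℝ} (hν : -(1 / 2) < ν) (n : ℕ) :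
    0 ≤ oddMoment ν n ∧ (2 * ν + 1) * oddMoment ν n ≤ 1 := by
  induction n with
  | zero =>
    have h := oddMoment_zero hν
    exact ⟨by by_contra! h'; nlinarith, h.le⟩
  | succ n ih =>
    have h := oddMoment_succ hν n
    have hn : (0 : ℝ) ≤ n := n.cast_nonneg
    have h0 : 0 ≤ oddMoment ν (n + 1) := by
      by_contra! h'
      nlinarith [mul_nonneg (by linarith : (0 : ℝ) ≤ 2 * n + 2) ih.1]
    have h1 : oddMoment ν (n + 1) ≤ oddMoment ν n := by
      by_contra! h'
      nlinarith
    exact ⟨h0, by nlinarith [ih.2]⟩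

lemma factorial_two_mul_succ_add_one (n : ℕ) :
    ((2 * (n + 1) + 1).factorial : ℝ) =
      (2 * n + 3) * ((2 * n + 2) * (2 * n + 1).factorial) := by
  rw [show 2 * (n + 1) + 1 = (2 * n + 1 + 1) + 1 by ring, Nat.factorial_succ,
    Nat.factorial_succ]
  push_cast
  ring

lemma sinMoment_succ {ν : ℝ} (hν : -(1 / 2) < ν) (n : ℕ) :
    (2 * ν + 2 * n + 3) * (2 * n + 3) * sinMoment ν (n + 1) = -sinMoment ν n := by
  have h := oddMoment_succ hν n
  have hp : ((2 * n + 1).factorial : ℝ) ≠ 0 := by positivity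
  rw [sinMoment, sinMoment, factorial_two_mul_succ_add_one]
  field_simp
  rw [pow_succ]
  linear_combination (-(-1) ^ n) * h

lemma abs_sinMoment_le {ν : ℝ} (hν : -(1 / 2) < ν) (n : ℕ) :
    |(2 * ν + 1) * sinMoment ν n| ≤ 1 / (2 * n + 1).factorial := by
  obtain ⟨h0, h1⟩ := oddMoment_nonneg_and_le hν n
  have h2 : 0 ≤ (2 * ν + 1) * oddMoment ν n := mul_nonneg (by linarith) h0
  rw [show (2 * ν + 1) * sinMoment ν n =
    (-1) ^ n * ((2 * ν + 1) * oddMoment ν n / (2 * n + 1).factorial) by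
      rw [sinMoment]; ring, abs_mul, abs_pow, abs_neg, abs_one, one_pow, one_mul,
    abs_of_nonneg (by positivity)]
  gcongr

lemma abs_succ_mul_sinMoment_le {ν : ℝ} (hν : -(1 / 2) < ν) (n : ℕ) :
    |(n + 1) * ((2 * ν + 1) * sinMoment ν n)| ≤ 1 / n.factorial := by
  have hf : ((n + 1 : ℝ)) * n.factorial ≤ (2 * n + 1).factorial := by
    exact_mod_cast (Nat.factorial_succ n).symm.le.trans
      (Nat.factorial_le (by lia : n + 1 ≤ 2 * n + 1))
  rw [abs_mul, abs_of_nonneg (by positivity : (0 : ℝ) ≤ n + 1)]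
  calc (n + 1 : ℝ) * |(2 * ν + 1) * sinMoment ν n|
      ≤ (n + 1) * (1 / (2 * n + 1).factorial) := by gcongr; exact abs_sinMoment_le hν n
    _ ≤ (n + 1) * (1 / ((n + 1) * n.factorial)) := by gcongr
    _ = 1 / n.factorial := by field_simp

lemma struve_coeff_eq {ν : ℝ} (hν : -(1 / 2) < ν) (n : ℕ) :
    Real.sqrt Real.pi / 2 * ((-1) ^ n * Real.Gamma (ν + 3 / 2) /
      (4 ^ n * Real.Gamma ((n : ℝ) + 3 / 2) * Real.Gamma (ν + n + 3 / 2))) =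
      (2 * ν + 1) * sinMoment ν n := by
  induction n with
  | zero =>
    have hG : Real.Gamma (3 / 2) = Real.sqrt Real.pi / 2 := by
      rw [show (3 / 2 : ℝ) = 1 / 2 + 1 by norm_num, Real.Gamma_add_one (by norm_num),
        Real.Gamma_one_half_eq]
      ring
    have hp : Real.Gamma (ν + 3 / 2) ≠ 0 := (Real.Gamma_pos_of_pos (by linarith)).ne'
    have hπ : Real.sqrt Real.pi ≠ 0 := by positivity
    have h := oddMoment_zero hν
    simp only [sinMoment, pow_zero, one_mul, Nat.cast_zero, zero_add, mul_zero, hG, add_zero,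
      Nat.factorial_one, Nat.cast_one, div_one, h]
    generalize Real.Gamma (ν + 3 / 2) = a at *
    field_simp
  | succ n ih =>
    have hn : (0 : ℝ) ≤ n := n.cast_nonneg
    have h1 : Real.Gamma (((n + 1 : ℕ) : ℝ) + 3 / 2) =
        (n + 3 / 2) * Real.Gamma ((n : ℝ) + 3 / 2) := by
      rw [← Real.Gamma_add_one (by positivity)]
      push_cast
      ring_nf
    have h2 : Real.Gamma (ν + (n + 1 : ℕ) + 3 / 2) =
        (ν + n + 3 / 2) * Real.Gamma (ν + n + 3 / 2) := by
      rw [← Real.Gamma_add_one (by linarith)]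
      push_cast
      ring_nf
    have hc : (2 * ν + 2 * n + 3) * (2 * n + 3) ≠ 0 :=
      mul_ne_zero (by linarith) (by linarith)
    refine mul_left_cancel₀ hc ?_
    rw [show (2 * ν + 2 * n + 3) * (2 * n + 3) * ((2 * ν + 1) * sinMoment ν (n + 1)) =
      -((2 * ν + 1) * sinMoment ν n) by
        linear_combination (2 * ν + 1) * sinMoment_succ hν n, ← ih, h1, h2]
    have hp1 : Real.Gamma (ν + n + 3 / 2) ≠ 0 := (Real.Gamma_pos_of_pos (by linarith)).ne'
    have hp2 : Real.Gamma ((n : ℝ) + 3 / 2) ≠ 0 := (Real.Gamma_pos_of_pos (by linarith)).ne'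
    have hq1 : ν + n + 3 / 2 ≠ 0 := by linarith
    have hq2 : (n : ℝ) + 3 / 2 ≠ 0 := by linarith
    rw [show (2 * ν + 2 * n + 3) * (2 * n + 3) = 4 * (ν + n + 3 / 2) * (n + 3 / 2) by ring,
      pow_succ, pow_succ]
    generalize ν + n + 3 / 2 = a at *
    generalize (n : ℝ) + 3 / 2 = b at *
    field_simp

lemma struveHR_eq_tsum {ν : ℝ} (hν : -(1 / 2) < ν) :
    struveHR ν = fun x => ∑' n : ℕ, (2 * ν + 1) * sinMoment ν n * x ^ (n + 1) := by
  funext x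
  rw [struveHR, ← tsum_mul_left]
  congr 1
  funext n
  rw [← struve_coeff_eq hν n]
  ring

lemma hasSum_deriv_struveHR_one {ν : ℝ} (hν : -(1 / 2) < ν) :
    HasSum (fun n : ℕ => (n + 1) * ((2 * ν + 1) * sinMoment ν n)) (deriv (struveHR ν) 1) := by
  have hd : HasDerivAt (struveHR ν)
      (∑' n : ℕ, (2 * ν + 1) * sinMoment ν n * ((n + 1 : ℕ) * 1 ^ n)) 1 := by
    rw [struveHR_eq_tsum hν]
    refine hasDerivAt_tsum_of_isPreconnected (t := Metric.ball 0 2) (y₀ := 0)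
      (g := fun n x => (2 * ν + 1) * sinMoment ν n * x ^ (n + 1))
      (g' := fun n x => (2 * ν + 1) * sinMoment ν n * ((n + 1 : ℕ) * x ^ n))
      (Real.summable_pow_div_factorial 2) Metric.isOpen_ball
      (convex_ball 0 2).isPreconnected ?_ ?_ ?_ ?_ ?_
    · intro n x _
      simpa using (hasDerivAt_pow (n + 1) x).const_mul ((2 * ν + 1) * sinMoment ν n)
    · intro n x hx
      have hx2 : |x| ≤ 2 := by simpa using (mem_ball_zero_iff.mp hx).le
      rw [show (2 * ν + 1) * sinMoment ν n * ((n + 1 : ℕ) * x ^ n) =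
        (n + 1) * ((2 * ν + 1) * sinMoment ν n) * x ^ n by push_cast; ring, norm_mul, norm_pow,
        Real.norm_eq_abs, Real.norm_eq_abs, ← one_div_mul_eq_div]
      gcongr
      exact abs_succ_mul_sinMoment_le hν n
    · simp
    · simp
    · simp
  rw [hd.deriv]
  have hs : Summable (fun n : ℕ => (n + 1) * ((2 * ν + 1) * sinMoment ν n)) := by
    refine Summable.of_norm_bounded (g := fun n : ℕ => (1 : ℝ) ^ n / n.factorial)
      (Real.summable_pow_div_factorial 1) fun n => ?_
    simpa using abs_succ_mul_sinMoment_le hν n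
  convert hs.hasSum using 3
  push_cast
  ring

lemma hasSum_integral_weight_mul_sin {ν : ℝ} (hν : -(1 / 2) < ν) :
    HasSum (fun n : ℕ => 2 * ν * sinMoment ν n - (2 * n + 2) * (2 * n + 3) * sinMoment ν (n + 1))
      (∫ t in (0 : ℝ)..1, (1 - t ^ 2) ^ (ν - 1 / 2) * (2 * ν + t ^ 2) * Real.sin t) := by
  have hw : IntervalIntegrable
      (fun t : ℝ => (1 - t ^ 2) ^ (ν - 1 / 2) * (2 * ν + t ^ 2)) MeasureTheory.volume 0 1 :=
    intervalIntegrable_weight_mul hν (by fun_prop)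
  have h := intervalIntegral.hasSum_integral_of_dominated_convergence (a := 0) (b := 1)
    (μ := MeasureTheory.volume)
    (F := fun (n : ℕ) (t : ℝ) => (1 - t ^ 2) ^ (ν - 1 / 2) * (2 * ν + t ^ 2) *
      ((-1) ^ n * t ^ (2 * n + 1) / (2 * n + 1).factorial))
    (f := fun t : ℝ => (1 - t ^ 2) ^ (ν - 1 / 2) * (2 * ν + t ^ 2) * Real.sin t)
    (fun n t => |(1 - t ^ 2) ^ (ν - 1 / 2) * (2 * ν + t ^ 2)| * (1 ^ n / n.factorial))
    (fun n => by
      have hc : Continuous fun t : ℝ => (-1) ^ n * t ^ (2 * n + 1) / (2 * n + 1).factorial := by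
        fun_prop
      exact (hw.mul_continuousOn hc.continuousOn).def'.aestronglyMeasurable)
    (fun n => Filter.Eventually.of_forall fun t ht => by
      rw [Set.uIoc_of_le zero_le_one] at ht
      rw [norm_mul, Real.norm_eq_abs, Real.norm_eq_abs, abs_div,
        abs_mul ((-1) ^ n), abs_pow, abs_neg, abs_one, one_pow, one_mul, Nat.abs_cast,
        abs_of_nonneg (pow_nonneg ht.1.le _)]
      gcongr
      · exact pow_le_one₀ ht.1.le ht.2
      · lia)
    (Filter.Eventually.of_forall fun t _ => (Real.summable_pow_div_factorial 1).mul_left _)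
    (by
      simp only [tsum_mul_left]
      exact hw.abs.mul_const _)
    (Filter.Eventually.of_forall fun t _ => (Real.hasSum_sin t).mul_left _)
  refine h.congr_fun fun n => ?_
  have hi := (intervalIntegrable_weight_mul hν (continuous_pow (2 * n + 1))).const_mul
    (2 * ν * ((-1) ^ n / (2 * n + 1).factorial))
  have hi' := (intervalIntegrable_weight_mul hν (continuous_pow (2 * (n + 1) + 1))).const_mul
    ((-1) ^ n / (2 * n + 1).factorial : ℝ)
  have hF : ∀ t : ℝ, (1 - t ^ 2) ^ (ν - 1 / 2) * (2 * ν + t ^ 2) *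
      ((-1) ^ n * t ^ (2 * n + 1) / (2 * n + 1).factorial) =
      2 * ν * ((-1) ^ n / (2 * n + 1).factorial) *
        ((1 - t ^ 2) ^ (ν - 1 / 2) * t ^ (2 * n + 1)) +
      (-1) ^ n / (2 * n + 1).factorial *
        ((1 - t ^ 2) ^ (ν - 1 / 2) * t ^ (2 * (n + 1) + 1)) := fun t => by ring
  simp only [hF]
  rw [intervalIntegral.integral_add hi hi', intervalIntegral.integral_const_mul,
    intervalIntegral.integral_const_mul, ← oddMoment, ← oddMoment, sinMoment, sinMoment]
  have hp : ((2 * n + 1).factorial : ℝ) ≠ 0 := by positivity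
  rw [factorial_two_mul_succ_add_one]
  field_simp
  ring

lemma hasSum_telescope {ν : ℝ} (hν : -(1 / 2) < ν) :
    HasSum (fun n : ℕ => (2 * n + 1) * ((2 * ν + 1) * sinMoment ν n) -
      (2 * n + 3) * ((2 * ν + 1) * sinMoment ν (n + 1))) 1 := by
  have hs : Summable (fun n : ℕ => (2 * n + 1) * ((2 * ν + 1) * sinMoment ν n)) := by
    refine Summable.of_norm_bounded
      (g := fun n : ℕ => 2 * ‖(n + 1) * ((2 * ν + 1) * sinMoment ν n)‖)
      ((hasSum_deriv_struveHR_one hν).summable.norm.mul_left 2) fun n => ?_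
    rw [norm_mul, norm_mul ((n : ℝ) + 1), ← mul_assoc, Real.norm_of_nonneg (by positivity),
      Real.norm_of_nonneg (by positivity : (0 : ℝ) ≤ n + 1)]
    gcongr
    linarith
  have h := hs.hasSum.sub ((hasSum_nat_add_iff' 1).mpr hs.hasSum)
  rw [sub_sub_cancel, Finset.sum_range_one] at h
  simp only [Nat.cast_zero, mul_zero, zero_add, one_mul] at h
  rw [show (2 * ν + 1) * sinMoment ν 0 = 1 by simpa [sinMoment] using oddMoment_zero hν] at h
  refine h.congr_fun fun n => ?_
  push_cast
  ring

/-- For `ν > -1/2`, `2 h_ν'(1) = 1 + ∫₀¹ (1 − t²)^(ν−1/2) (2ν + t²) sin t dt`. -/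
theorem struveH_deriv_one_integral (ν : ℝ) (hν : -(1 / 2) < ν) :
    2 * deriv (struveHR ν) 1 =
      1 + ∫ t in (0 : ℝ)..1, (1 - t ^ 2) ^ (ν - 1 / 2) * (2 * ν + t ^ 2) * Real.sin t := by
  refine ((hasSum_deriv_struveHR_one hν).mul_left 2).unique ?_
  refine ((hasSum_telescope hν).add (hasSum_integral_weight_mul_sin hν)).congr_fun fun n => ?_
  linear_combination sinMoment_succ hν n
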